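/- arXiv:1208.3867 — 9 statements merged into one kernel-verified Lean document; each statement's English description precedes it below -/
import Mathlib

section
/- Let n ≥ 1 and let M be an n×n matrix with integer entries such that every row of M is of type 1–9. Then the absolute value of the determinant of M is at most 2^n. -/
/-- A vector in `ℤ^n` is of type 1–9 if it is obtained from one of the nine patterns
`(1), (2), (1,1), (1,−1), (2,−1), (1,1,−1), (2,−2), (2,−1,−1), (1,1,−1,−1)`
by appending zeros to reach length `n`, permuting the coordinates arbitrarily,
and possibly multiplying all coordinates by `−1`. -/
def IsType19 {n : ℕ} (x : Fin n → ℤ) : Prop :=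
  ∃ p ∈ ([[1], [2], [1, 1], [1, -1], [2, -1], [1, 1, -1], [2, -2], [2, -1, -1],
      [1, 1, -1, -1]] : List (List ℤ)),
    p.length ≤ n ∧ ∃ ε : ℤ, (ε = 1 ∨ ε = -1) ∧
      ∃ σ : Equiv.Perm (Fin n), ∀ i : Fin n, x (σ i) = ε * p.getD (i : ℕ) 0

/-- Indicator-difference matrices have determinant in `{-1,0,1}`. -/
theorem abs_det_incidence_le_one : ∀ (n : ℕ) (f : Fin n → ℕ) (_ : Function.Injective f)
    (a b : Fin n → ℕ),
    |(Matrix.of fun i k => (if f k = a i then (1 : ℤ) else 0) - (if f k = b i then 1 else 0)).det|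
      ≤ 1 := by
  intro n
  induction n with
  | zero => intro f _ a b; simp
  | succ n ih =>
    intro f hf a b
    by_cases hall : ∀ i, (∃ k, f k = a i) ∧ (∃ k, f k = b i)
    · have h0 : (Matrix.of fun i k => (if f k = a i then (1 : ℤ) else 0) -
          (if f k = b i then 1 else 0)).det = 0 := by
        rw [← Matrix.exists_mulVec_eq_zero_iff]
        refine ⟨fun _ => 1, fun h => by simpa using congrFun h 0, ?_⟩
        funext i
        obtain ⟨⟨k, hk⟩, ⟨l, hl⟩⟩ := hall i
        simp [Matrix.mulVec, dotProduct, ← hk, ← hl, hf.eq_iff]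
      rw [h0]; simp
    · push Not at hall
      obtain ⟨i, hi⟩ := hall
      -- row `i` has at most one nonzero entry, of absolute value at most one
      obtain ⟨j, hj1, hj⟩ : ∃ j : Fin (n+1),
          |(if f j = a i then (1 : ℤ) else 0) - (if f j = b i then 1 else 0)| ≤ 1 ∧
          ∀ k, k ≠ j → (if f k = a i then (1 : ℤ) else 0) - (if f k = b i then 1 else 0) = 0 := by
        have key : ∀ j, |(if f j = a i then (1 : ℤ) else 0) - (if f j = b i then 1 else 0)| ≤ 1 := by
          intro j; split_ifs <;> simp
        by_cases ha : ∃ k, f k = a i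
        · have hb := hi ha
          obtain ⟨k, hk⟩ := ha
          refine ⟨k, key k, fun l hl => ?_⟩
          simp [hb l, ← hk, hf.eq_iff, hl]
        · push Not at ha
          by_cases hb : ∃ k, f k = b i
          · obtain ⟨k, hk⟩ := hb
            refine ⟨k, key k, fun l hl => ?_⟩
            simp [ha l, ← hk, hf.eq_iff, hl]
          · push Not at hb
            exact ⟨0, key 0, fun l _ => by simp [ha l, hb l]⟩
      rw [Matrix.det_succ_row _ i, Finset.sum_eq_single j]
      · rw [abs_mul, abs_mul, abs_pow, abs_neg, abs_one, one_pow, one_mul]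
        have := ih (f ∘ j.succAbove) (hf.comp Fin.succAbove_right_injective)
          (a ∘ i.succAbove) (b ∘ i.succAbove)
        exact mul_le_one₀ hj1 (abs_nonneg _) this
      · intro k _ hk
        rw [Matrix.of_apply, hj k hk]; simp
      · simp

/-- Every pattern is a sum of two indicator differences. -/
theorem pattern_decomp (n : ℕ) (p : List ℤ)
    (hp : p ∈ ([[1], [2], [1, 1], [1, -1], [2, -1], [1, 1, -1], [2, -2], [2, -1, -1],
      [1, 1, -1, -1]] : List (List ℤ))) :
    ∃ a b c d : ℕ, ∀ i : ℕ, i < n → p.getD i 0 =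
      ((if i = a then (1 : ℤ) else 0) - (if i = b then 1 else 0)) +
      ((if i = c then (1 : ℤ) else 0) - (if i = d then 1 else 0)) := by
  have main : ∃ a b c d : ℕ, ∀ i : ℕ, i < n + 4 → p.getD i 0 =
      ((if i = a then (1 : ℤ) else 0) - (if i = b then 1 else 0)) +
      ((if i = c then (1 : ℤ) else 0) - (if i = d then 1 else 0)) := by
    simp only [List.mem_cons, List.not_mem_nil, or_false] at hp
    rcases hp with rfl | rfl | rfl | rfl | rfl | rfl | rfl | rfl | rfl
    · refine ⟨0, n+4, n+4, n+4, ?_⟩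
      rintro (_ | i) hi <;> simp <;> grind
    · refine ⟨0, n+4, 0, n+4, ?_⟩
      rintro (_ | i) hi <;> simp <;> grind
    · refine ⟨0, n+4, 1, n+4, ?_⟩
      rintro (_ | _ | i) hi <;> simp <;> grind
    · refine ⟨0, 1, n+4, n+4, ?_⟩
      rintro (_ | _ | i) hi <;> simp <;> grind
    · refine ⟨0, 1, 0, n+4, ?_⟩
      rintro (_ | _ | i) hi <;> simp <;> grind
    · refine ⟨0, 2, 1, n+4, ?_⟩
      rintro (_ | _ | _ | i) hi <;> simp <;> grind
    · refine ⟨0, 1, 0, 1, ?_⟩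
      rintro (_ | _ | i) hi <;> simp
    · refine ⟨0, 1, 0, 2, ?_⟩
      rintro (_ | _ | _ | i) hi <;> simp
    · refine ⟨0, 2, 1, 3, ?_⟩
      rintro (_ | _ | _ | _ | i) hi <;> simp
  obtain ⟨a, b, c, d, h⟩ := main
  exact ⟨a, b, c, d, fun i hi => h i (by omega)⟩

theorem row_decomp {n : ℕ} (x : Fin n → ℤ) (hx : IsType19 x) :
    ∃ a b c d : ℕ, ∀ k : Fin n, x k =
      ((if (k : ℕ) = a then (1 : ℤ) else 0) - (if (k : ℕ) = b then 1 else 0)) +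
      ((if (k : ℕ) = c then (1 : ℤ) else 0) - (if (k : ℕ) = d then 1 else 0)) := by
  obtain ⟨p, hp, -, ε, hε, σ, hσ⟩ := hx
  obtain ⟨a, b, c, d, h⟩ := pattern_decomp n p hp
  have hg : ∀ m : ℕ, ∃ g : ℕ, ∀ i : Fin n, ((σ i : Fin n) : ℕ) = g ↔ (i : ℕ) = m := by
    intro m
    by_cases hm : m < n
    · refine ⟨σ ⟨m, hm⟩, fun i => ?_⟩
      rw [Fin.val_inj, σ.injective.eq_iff, Fin.ext_iff]
    · refine ⟨n, fun i => ?_⟩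
      have := (σ i).isLt
      have := i.isLt
      omega
  choose g hg using hg
  rcases hε with rfl | rfl
  · refine ⟨g a, g b, g c, g d, fun k => ?_⟩
    obtain ⟨i, rfl⟩ := σ.surjective k
    simp only [hg]
    rw [hσ, h i i.isLt]; ring
  · refine ⟨g b, g a, g d, g c, fun k => ?_⟩
    obtain ⟨i, rfl⟩ := σ.surjective k
    simp only [hg]
    rw [hσ, h i i.isLt]; ring

theorem det_abs_le_two_pow (n : ℕ) (hn : 1 ≤ n) (M : Matrix (Fin n) (Fin n) ℤ)
    (hM : ∀ i : Fin n, IsType19 (M i)) :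
    |M.det| ≤ 2 ^ n := by
  choose a b c d h using fun i => row_decomp (M i) (hM i)
  let U : Fin n → Fin n → ℤ := fun i k =>
    (if (k : ℕ) = a i then (1 : ℤ) else 0) - (if (k : ℕ) = b i then 1 else 0)
  let V : Fin n → Fin n → ℤ := fun i k =>
    (if (k : ℕ) = c i then (1 : ℤ) else 0) - (if (k : ℕ) = d i then 1 else 0)
  have hUV : M.det = (Matrix.detRowAlternating (R := ℤ) (n := Fin n)).toMultilinearMap (U + V) := by
    change M.det = Matrix.det (U + V)
    congr 1
    funext i k
    exact h i k
  rw [hUV, MultilinearMap.map_add_univ]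
  refine (Finset.abs_sum_le_sum_abs _ _).trans ?_
  have hs : ∀ s ∈ (Finset.univ : Finset (Finset (Fin n))),
      |(Matrix.detRowAlternating (R := ℤ) (n := Fin n)).toMultilinearMap (s.piecewise U V)| ≤ 1 := by
    intro s _
    have := abs_det_incidence_le_one n (fun k => (k : ℕ)) Fin.val_injective
      (s.piecewise a c) (s.piecewise b d)
    convert this using 2
    change Matrix.det (s.piecewise U V) = _
    congr 1
    funext i k
    by_cases hi : i ∈ s <;> simp [hi, U, V]
  refine (Finset.sum_le_card_nsmul _ _ _ hs).trans ?_
  simp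
end

section
/- Let n ≥ 2 and let x ∈ ℤ^n be of type 1–9. Then for every index k, the vector in ℤ^{n−1} obtained from x by deleting the k-th coordinate is either the zero vector or again of type 1–9. -/
theorem type19_exists_perm (n : ℕ) (σ : Equiv.Perm (Fin (n + 1))) (j : Fin (n + 1)) :
    ∃ τ : Equiv.Perm (Fin n), ∀ i, (σ j).succAbove (τ i) = σ (j.succAbove i) := by
  let e : {a // a ≠ j} ≃ {a // a ≠ σ j} := σ.subtypeEquiv (fun a => by simp)
  refine ⟨(finSuccAboveEquiv j).trans (e.trans (finSuccAboveEquiv (σ j)).symm), fun i => ?_⟩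
  have h := (finSuccAboveEquiv (σ j)).apply_symm_apply (e (finSuccAboveEquiv j i))
  have h2 := congrArg Subtype.val h
  exact h2

theorem type19_getD_erase (n : ℕ) (p : List ℤ) (j : Fin (n + 1)) (i : Fin n) :
    p.getD (j.succAbove i : ℕ) 0 = (p.eraseIdx j).getD (i : ℕ) 0 := by
  simp only [List.getD_eq_getElem?_getD, List.getElem?_eraseIdx, Fin.succAbove, Fin.lt_def]
  split_ifs <;> simp_all

/-- Every one-entry deletion from a pattern is empty, a pattern, the negative of a pattern,
or the exceptional list `(1,-1,-1)`. -/
theorem type19_erase_cases (p : List ℤ)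
    (hp : p ∈ ([[1], [2], [1, 1], [1, -1], [2, -1], [1, 1, -1], [2, -2], [2, -1, -1],
      [1, 1, -1, -1]] : List (List ℤ))) (j : ℕ) (hj : j < p.length) :
    p.eraseIdx j = [] ∨ p.eraseIdx j = [1, -1, -1] ∨
    ∃ q ∈ ([[1], [2], [1, 1], [1, -1], [2, -1], [1, 1, -1], [2, -2], [2, -1, -1],
      [1, 1, -1, -1]] : List (List ℤ)), p.eraseIdx j = q ∨ p.eraseIdx j = q.map (fun a => -a) := by
  revert j
  revert p
  decide

theorem type19_delete (n : ℕ) (hn : 1 ≤ n) (x : Fin (n + 1) → ℤ) (hx : IsType19 x)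
    (k : Fin (n + 1)) :
    (fun i : Fin n => x (k.succAbove i)) = 0 ∨
      IsType19 (fun i : Fin n => x (k.succAbove i)) := by
  obtain ⟨p, hp, hlen, ε, hε, σ, hσ⟩ := hx
  obtain ⟨j, rfl⟩ := σ.surjective k
  obtain ⟨τ, hτ⟩ := type19_exists_perm n σ j
  have key : ∀ i, x ((σ j).succAbove (τ i)) = ε * (p.eraseIdx j).getD (i : ℕ) 0 := by
    intro i
    rw [hτ, hσ, type19_getD_erase]
  have hε' : -ε = 1 ∨ -ε = -1 := by omega
  by_cases hj : (j : ℕ) < p.length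
  · have hl : (p.eraseIdx j).length ≤ n := by
      rw [List.length_eraseIdx_of_lt hj]; omega
    rcases type19_erase_cases p hp j hj with h | h | ⟨q, hq, h | h⟩
    · left
      funext i
      obtain ⟨i, rfl⟩ := τ.surjective i
      simp [key, h]
    · right
      rw [h] at key hl
      simp only [List.length_cons, List.length_nil] at hl
      refine ⟨[1, 1, -1], by simp, by simpa using hl, -ε, hε',
        (Equiv.swap ⟨0, by omega⟩ ⟨2, by omega⟩).trans τ, fun i => ?_⟩
      simp only [Equiv.trans_apply, key]
      obtain ⟨i, hi⟩ := i
      rw [Equiv.swap_apply_def]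
      rcases i with _ | _ | _ | i <;> simp
    · right
      rw [h] at key hl
      exact ⟨q, hq, hl, ε, hε, τ, key⟩
    · right
      rw [h] at key hl
      refine ⟨q, hq, by simpa using hl, -ε, hε', τ, fun i => ?_⟩
      simp only [key, List.getD_eq_getElem?_getD, List.getElem?_map]
      cases q[(i : ℕ)]? <;> simp
  · right
    rw [List.eraseIdx_of_length_le (by omega)] at key
    exact ⟨p, hp, by omega, ε, hε, τ, key⟩
end

section
/- Let n ≥ 2 and let x ∈ ℤ^n be of type 1–9. Then for any two distinct indices k and m, the vector in ℤ^{n−1} obtained from x by deleting the k-th coordinate and replacing the coordinate x_m by x_m + x_k is either the zero vector or again of type 1–9. -/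
lemma t19_decomp (S : Multiset ℤ) : ∃ (P N : Multiset ℤ) (z : ℕ),
    S = P + N.map (fun a => -a) + Multiset.replicate z 0 ∧ (∀ a ∈ P, 0 < a) ∧ (∀ a ∈ N, 0 < a) ∧
    P.sum = (S.map (fun a => max a 0)).sum ∧ N.sum = (S.map (fun a => max (-a) 0)).sum := by
  induction S using Multiset.induction with
  | empty => exact ⟨0, 0, 0, by simp⟩
  | cons a S ih =>
    obtain ⟨P, N, z, h, hP, hN, h1, h2⟩ := ih
    rcases lt_trichotomy a 0 with ha | ha | ha
    · refine ⟨P, (-a) ::ₘ N, z, ?_, hP, ?_, ?_, ?_⟩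
      · rw [h]; simp
      · intro b hb
        rcases Multiset.mem_cons.1 hb with rfl | hb
        · omega
        · exact hN b hb
      · rw [Multiset.map_cons, Multiset.sum_cons, ← h1, max_eq_right ha.le, zero_add]
      · rw [Multiset.map_cons, Multiset.sum_cons, Multiset.sum_cons, ← h2, max_eq_left (by omega)]
    · subst ha
      refine ⟨P, N, z + 1, ?_, hP, hN, ?_, ?_⟩
      · rw [h]; simp [Multiset.replicate_succ]
      · simpa using h1
      · simpa using h2
    · refine ⟨a ::ₘ P, N, z, ?_, ?_, hN, ?_, ?_⟩
      · rw [h]; simp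
      · intro b hb
        rcases Multiset.mem_cons.1 hb with rfl | hb
        · omega
        · exact hP b hb
      · rw [Multiset.map_cons, Multiset.sum_cons, Multiset.sum_cons, ← h1, max_eq_left ha.le]
      · rw [Multiset.map_cons, Multiset.sum_cons, ← h2, max_eq_right (by omega), zero_add]

lemma t19_sum_nonneg (P : Multiset ℤ) (h : ∀ a ∈ P, 0 < a) : 0 ≤ P.sum :=
  Multiset.sum_nonneg fun a ha => (h a ha).le

lemma t19_small (P : Multiset ℤ) (h : ∀ a ∈ P, 0 < a) (hs : P.sum ≤ 2) :
    P = 0 ∨ P = {1} ∨ P = {2} ∨ P = {1, 1} := by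
  rcases P.empty_or_exists_mem with rfl | ⟨a, ha⟩
  · simp
  obtain ⟨Q, rfl⟩ := Multiset.exists_cons_of_mem ha
  have ha0 := h a ha
  rcases Q.empty_or_exists_mem with rfl | ⟨b, hb⟩
  · simp only [Multiset.sum_cons, Multiset.sum_zero] at hs
    obtain rfl | rfl : a = 1 ∨ a = 2 := by omega
    · simp
    · simp
  obtain ⟨R, rfl⟩ := Multiset.exists_cons_of_mem hb
  have hb0 := h b (by simp)
  rcases R.empty_or_exists_mem with rfl | ⟨c, hc⟩
  · simp only [Multiset.sum_cons, Multiset.sum_zero] at hs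
    obtain ⟨rfl, rfl⟩ : a = 1 ∧ b = 1 := by omega
    simp
  obtain ⟨T, rfl⟩ := Multiset.exists_cons_of_mem hc
  have hc0 := h c (by simp)
  have := t19_sum_nonneg T fun a ha => h a (by simp [ha])
  simp only [Multiset.sum_cons] at hs
  omega

lemma t19_ofFn {n : ℕ} (p : List ℤ) (hp : p.length ≤ n) (ε : ℤ) :
    (Finset.univ.val.map fun i : Fin n => ε * p.getD (i : ℕ) 0) =
      ((p.map (fun a => ε * a) : List ℤ) : Multiset ℤ) + Multiset.replicate (n - p.length) 0 := by
  have : List.ofFn (fun i : Fin n => ε * p.getD (i : ℕ) 0) =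
      p.map (fun a => ε * a) ++ List.replicate (n - p.length) 0 := by
    apply List.ext_getElem
    · simp; omega
    · intro i h1 h2
      by_cases h : i < p.length
      · simp [List.getElem_append, h]
      · simp [List.getElem_append, h]
  rw [Fin.univ_val_map, this, ← Multiset.coe_replicate, Multiset.coe_add]

lemma t19_perm {n : ℕ} (f g : Fin n → ℤ) (h : Finset.univ.val.map f = Finset.univ.val.map g) :
    ∃ σ : Equiv.Perm (Fin n), f = g ∘ σ := by
  have e : ∀ c, Nonempty ({ a // f a = c } ≃ { b // g b = c }) := by
    intro c
    have := congrArg (Multiset.count c) h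
    rw [Multiset.count_map, Multiset.count_map] at this
    refine ⟨Fintype.equivOfCardEq ?_⟩
    rw [Fintype.card_subtype, Fintype.card_subtype]
    simp only [eq_comm (a := c)] at this
    exact this
  exact ⟨Equiv.ofFiberEquiv fun c => (e c).some,
    funext fun a => (Equiv.ofFiberEquiv_map (fun c => (e c).some) a).symm⟩

lemma t19_mk {n : ℕ} (x : Fin n → ℤ) (p : List ℤ) (hp : p ∈ ([[1], [2], [1, 1], [1, -1], [2, -1],
      [1, 1, -1], [2, -2], [2, -1, -1], [1, 1, -1, -1]] : List (List ℤ))) (ε : ℤ)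
      (hε : ε = 1 ∨ ε = -1) (z : ℕ)
      (h : Finset.univ.val.map x =
        ((p.map (fun a => ε * a) : List ℤ) : Multiset ℤ) + Multiset.replicate z 0) :
      IsType19 x := by
  have hc := congrArg Multiset.card h
  simp at hc
  have hz : z = n - p.length := by omega
  subst hz
  rw [← t19_ofFn p (by omega) ε] at h
  obtain ⟨σ, hσ⟩ := t19_perm _ _ h.symm
  exact ⟨p, hp, by omega, ε, hε, σ, fun i => (congrFun hσ i).symm⟩

lemma t19_sums {n : ℕ} (x : Fin n → ℤ) (hx : IsType19 x) :
    ∑ i, max (x i) 0 ≤ 2 ∧ ∑ i, max (-x i) 0 ≤ 2 := by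
  obtain ⟨p, hp, hl, ε, hε, σ, h⟩ := hx
  have key : ∀ f : ℤ → ℤ, f 0 = 0 → ∑ i, f (x i) = (p.map fun a => f (ε * a)).sum := by
    intro f hf
    rw [← Equiv.sum_comp σ]
    simp only [h]
    have := congrArg (fun S => (S.map f).sum) (t19_ofFn (n := n) p hl ε)
    simp [hf] at this
    simpa [Function.comp_def, List.sum_ofFn] using this
  rw [key (fun a => max a 0) (by simp), key (fun a => max (-a) 0) (by simp)]
  clear key h
  rcases hε with rfl | rfl <;> revert p <;> simp

lemma t19_of_sums {n : ℕ} (x : Fin n → ℤ) (h1 : ∑ i, max (x i) 0 ≤ 2)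
    (h2 : ∑ i, max (-x i) 0 ≤ 2) : x = 0 ∨ IsType19 x := by
  obtain ⟨P, N, z, h, hP, hN, hp, hn⟩ := t19_decomp (Finset.univ.val.map x)
  have hp2 : P.sum ≤ 2 := by rw [hp, Multiset.map_map]; exact h1
  have hn2 : N.sum ≤ 2 := by rw [hn, Multiset.map_map]; exact h2
  have mk := t19_mk x
  rcases t19_small P hP hp2 with rfl | rfl | rfl | rfl <;>
    rcases t19_small N hN hn2 with rfl | rfl | rfl | rfl
  · left
    funext i
    have : x i ∈ Finset.univ.val.map x := Multiset.mem_map_of_mem x (Finset.mem_univ_val i)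
    rw [h] at this
    simpa using Multiset.eq_of_mem_replicate (by simpa using this)
  all_goals right
  · exact mk [1] (by simp) (-1) (by simp) z (h.trans (congrArg (· + _) (by decide)))
  · exact mk [2] (by simp) (-1) (by simp) z (h.trans (congrArg (· + _) (by decide)))
  · exact mk [1, 1] (by simp) (-1) (by simp) z (h.trans (congrArg (· + _) (by decide)))
  · exact mk [1] (by simp) 1 (by simp) z (h.trans (congrArg (· + _) (by decide)))
  · exact mk [1, -1] (by simp) 1 (by simp) z (h.trans (congrArg (· + _) (by decide)))
  · exact mk [2, -1] (by simp) (-1) (by simp) z (h.trans (congrArg (· + _) (by decide)))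
  · exact mk [1, 1, -1] (by simp) (-1) (by simp) z (h.trans (congrArg (· + _) (by decide)))
  · exact mk [2] (by simp) 1 (by simp) z (h.trans (congrArg (· + _) (by decide)))
  · exact mk [2, -1] (by simp) 1 (by simp) z (h.trans (congrArg (· + _) (by decide)))
  · exact mk [2, -2] (by simp) 1 (by simp) z (h.trans (congrArg (· + _) (by decide)))
  · exact mk [2, -1, -1] (by simp) 1 (by simp) z (h.trans (congrArg (· + _) (by decide)))
  · exact mk [1, 1] (by simp) 1 (by simp) z (h.trans (congrArg (· + _) (by decide)))
  · exact mk [1, 1, -1] (by simp) 1 (by simp) z (h.trans (congrArg (· + _) (by decide)))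
  · exact mk [2, -1, -1] (by simp) (-1) (by simp) z (h.trans (congrArg (· + _) (by decide)))
  · exact mk [1, 1, -1, -1] (by simp) 1 (by simp) z (h.trans (congrArg (· + _) (by decide)))

lemma t19_merge_sum {n : ℕ} (f : ℤ → ℤ) (hf : ∀ a b, f (a + b) ≤ f a + f b)
    (x : Fin (n + 1) → ℤ) (k m : Fin (n + 1)) (hkm : k ≠ m) :
    ∑ i : Fin n, f (Function.update x m (x m + x k) (k.succAbove i)) ≤ ∑ i, f (x i) := by
  obtain ⟨j, rfl⟩ := Fin.exists_succAbove_eq hkm.symm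
  rw [Fin.sum_univ_succAbove _ k, ← Finset.add_sum_erase _ _ (Finset.mem_univ j),
    ← Finset.add_sum_erase _ (fun i => f (x (k.succAbove i))) (Finset.mem_univ j)]
  have : ∑ i ∈ Finset.univ.erase j, f (Function.update x (k.succAbove j)
      (x (k.succAbove j) + x k) (k.succAbove i)) =
      ∑ i ∈ Finset.univ.erase j, f (x (k.succAbove i)) := by
    apply Finset.sum_congr rfl
    intro i hi
    rw [Function.update_of_ne]
    exact fun h => (Finset.ne_of_mem_erase hi) (Fin.succAbove_right_injective h)
  rw [this, Function.update_self]
  linarith [hf (x (k.succAbove j)) (x k)]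

/-- Deleting the `k`-th coordinate of a type 1–9 vector of length `n + 1 ≥ 2` and adding
the removed entry `x k` onto another coordinate `x m` (`m ≠ k`) yields either the zero
vector or again a vector of type 1–9. -/
theorem type19_merge (n : ℕ) (hn : 1 ≤ n) (x : Fin (n + 1) → ℤ) (hx : IsType19 x)
    (k m : Fin (n + 1)) (hkm : k ≠ m) :
    (fun i : Fin n => Function.update x m (x m + x k) (k.succAbove i)) = 0 ∨
      IsType19 (fun i : Fin n => Function.update x m (x m + x k) (k.succAbove i)) := by
  obtain ⟨h1, h2⟩ := t19_sums x hx
  apply t19_of_sums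
  · exact (t19_merge_sum (fun a => max a 0) (by intro a b; omega) x k m hkm).trans h1
  · exact (t19_merge_sum (fun a => max (-a) 0) (by intro a b; omega) x k m hkm).trans h2
end

section
/- Let n ≥ 1 and let p be an integer with 1 ≤ p ≤ 2^n. Then there exists an n×n integer matrix M, all of whose rows are of type 1–9, such that the cokernel of M — the quotient of the additive group ℤ^n by the subgroup generated by the columns of M — is isomorphic as an additive group to ℤ/pℤ. -/
/-- Binary expansion. -/
lemma exists_bits : ∀ (n q : ℕ), q < 2 ^ n → ∃ b : Fin n → ℤ,
    (∀ i, b i = 0 ∨ b i = 1) ∧ ∑ i, b i * 2 ^ (i : ℕ) = (q : ℤ)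
  | 0, q, h => ⟨fun _ => 0, fun _ => Or.inl rfl, by simp at h; simp [h]⟩
  | n + 1, q, h => by
    obtain ⟨b, hb, hs⟩ := exists_bits n (q / 2) (by rw [pow_succ] at h; omega)
    refine ⟨Fin.cons ((q % 2 : ℕ) : ℤ) b, ?_, ?_⟩
    · intro i
      refine Fin.cases ?_ (fun j => ?_) i
      · simp only [Fin.cons_zero]; omega
      · simpa using hb j
    · rw [Fin.sum_univ_succ]
      simp only [Fin.cons_zero, Fin.cons_succ, Fin.val_zero, Fin.val_succ, pow_succ, ← mul_assoc]
      rw [← Finset.sum_mul, hs]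
      push_cast
      omega

/-- A criterion for a vector to be of type 1–9. -/
lemma isType19_of {n : ℕ} (x : Fin n → ℤ) (l : List ℤ)
    (hl : l ∈ ([[1], [2], [1, 1], [1, -1], [2, -1], [1, 1, -1], [2, -2], [2, -1, -1],
      [1, 1, -1, -1]] : List (List ℤ)))
    (f : Fin l.length → Fin n) (hf : Function.Injective f)
    (h1 : ∀ t, x (f t) = l.get t) (h0 : ∀ i, (∀ t, i ≠ f t) → x i = 0) : IsType19 x := by
  have hle : l.length ≤ n := by simpa using Fintype.card_le_of_injective f hf
  refine ⟨l, hl, hle, 1, Or.inl rfl, ?_⟩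
  have := Equiv.Perm.isMultiplyPretransitive (Fin n) l.length
  obtain ⟨σ, hσ⟩ := MulAction.exists_smul_eq (Equiv.Perm (Fin n))
    (Fin.castLEEmb hle : Fin l.length ↪ Fin n) ⟨f, hf⟩
  have hσ' : ∀ t : Fin l.length, σ (Fin.castLE hle t) = f t := fun t =>
    DFunLike.congr_fun hσ t
  refine ⟨σ, fun i => ?_⟩
  by_cases hi : (i : ℕ) < l.length
  · have h2 := hσ' ⟨i, hi⟩
    have h3 : Fin.castLE hle ⟨i, hi⟩ = i := rfl
    rw [h3] at h2
    rw [h2, h1]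
    simp [hi]
  · rw [h0]
    · rw [List.getD_eq_default _ _ (not_lt.mp hi), mul_zero]
    · intro t ht
      rw [← hσ' t] at ht
      have := σ.injective ht
      apply hi
      rw [this]
      exact t.2

lemma isType19_one {n : ℕ} (x : Fin n → ℤ) (a : Fin n) (u : ℤ)
    (hl : [u] ∈ ([[1], [2]] : List (List ℤ)))
    (h : ∀ i, x i = if i = a then u else 0) : IsType19 x := by
  refine isType19_of x [u] (by simp at hl ⊢; omega) ![a] ?_ ?_ ?_
  · intro s t _; exact Subsingleton.elim (α := Fin 1) s t
  · intro t; fin_cases t; simp [h]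
  · intro i hi
    have := hi (0 : Fin 1)
    simp at this
    simp [h, this]

lemma isType19_two {n : ℕ} (x : Fin n → ℤ) (a b : Fin n) (hab : a ≠ b) (u v : ℤ)
    (hl : [u, v] ∈ ([[1, -1], [2, -1]] : List (List ℤ)))
    (h : ∀ i, x i = if i = a then u else if i = b then v else 0) : IsType19 x := by
  refine isType19_of x [u, v] (by simp at hl ⊢; omega) ![a, b] ?_ ?_ ?_
  · intro s t hst
    fin_cases s <;> fin_cases t <;> simp_all
  · intro t; fin_cases t <;> simp [h, hab.symm]
  · intro i hi
    have h0 := hi (0 : Fin 2)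
    have h1 := hi (1 : Fin 2)
    simp at h0 h1
    simp [h, h0, h1]

lemma isType19_three {n : ℕ} (x : Fin n → ℤ) (a b c : Fin n) (hab : a ≠ b) (hac : a ≠ c)
    (hbc : b ≠ c)
    (h : ∀ i, x i = if i = a then 2 else if i = b then -1 else if i = c then -1 else 0) :
    IsType19 x := by
  refine isType19_of x [2, -1, -1] (by simp) ![a, b, c] ?_ ?_ ?_
  · intro s t hst
    fin_cases s <;> fin_cases t <;> simp_all
  · intro t; fin_cases t <;> simp [h, hab.symm, hac.symm, hbc.symm]
  · intro i hi
    have h0 := hi (0 : Fin 3)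
    have h1 := hi (1 : Fin 3)
    have h2 := hi (2 : Fin 3)
    simp at h0 h1 h2
    simp [h, h0, h1, h2]

/-- The matrix: column `j < m` is `2 e_j - e_{j+1}`, the last is `2 e_m - ∑ b_i e_i`. -/
def theMat (m : ℕ) (b : Fin (m + 1) → ℤ) : Matrix (Fin (m + 1)) (Fin (m + 1)) ℤ :=
  fun i j => (if i = j then 2 else 0) - (if (i : ℕ) = j + 1 then 1 else 0)
    - (if (j : ℕ) = m then b i else 0)

lemma theMat_type (m : ℕ) (b : Fin (m + 1) → ℤ) (hb : ∀ i, b i = 0 ∨ b i = 1)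
    (i : Fin (m + 1)) : IsType19 (theMat m b i) := by
  have hi := i.2
  rcases hb i with h | h
  · by_cases h0 : (i : ℕ) = 0
    · refine isType19_one _ i 2 (by simp) fun j => ?_
      simp only [theMat, h, Fin.ext_iff]
      split_ifs <;> omega
    · refine isType19_two _ i ⟨i - 1, by omega⟩ (by simp [Fin.ext_iff]; omega) 2 (-1) (by simp)
        fun j => ?_
      simp only [theMat, h, Fin.ext_iff]
      split_ifs <;> omega
  · by_cases h0 : (i : ℕ) = 0
    · by_cases hm : m = 0
      · refine isType19_one _ i 1 (by simp) fun j => ?_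
        have := j.2
        simp only [theMat, h, Fin.ext_iff]
        split_ifs <;> omega
      · refine isType19_two _ i (Fin.last m) (by simp [Fin.ext_iff]; omega) 2 (-1) (by simp)
          fun j => ?_
        simp only [theMat, h, Fin.ext_iff, Fin.val_last]
        split_ifs <;> omega
    · by_cases hm : (i : ℕ) = m
      · refine isType19_two _ i ⟨i - 1, by omega⟩ (by simp [Fin.ext_iff]; omega) 1 (-1) (by simp)
          fun j => ?_
        simp only [theMat, h, Fin.ext_iff]
        split_ifs <;> omega
      · refine isType19_three _ i ⟨i - 1, by omega⟩ (Fin.last m) (by simp [Fin.ext_iff]; omega)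
          (by simp [Fin.ext_iff]; omega) (by simp [Fin.ext_iff]; omega) fun j => ?_
        simp only [theMat, h, Fin.ext_iff, Fin.val_last]
        split_ifs <;> omega

lemma theMat_col_lt (m : ℕ) (b : Fin (m + 1) → ℤ) (j : ℕ) (hj : j < m) :
    (theMat m b).transpose ⟨j, by omega⟩ =
      (2 : ℤ) • Pi.single (⟨j, by omega⟩ : Fin (m + 1)) (1 : ℤ)
        - Pi.single (⟨j + 1, by omega⟩ : Fin (m + 1)) (1 : ℤ) := by
  funext i
  simp only [Matrix.transpose_apply, theMat, Pi.sub_apply, Pi.smul_apply, Pi.single_apply,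
    Fin.ext_iff, smul_eq_mul]
  split_ifs <;> omega

lemma theMat_col_last (m : ℕ) (b : Fin (m + 1) → ℤ) :
    (theMat m b).transpose (Fin.last m) =
      (2 : ℤ) • Pi.single (Fin.last m) (1 : ℤ) - b := by
  funext i
  have := i.2
  simp only [Matrix.transpose_apply, theMat, Pi.sub_apply, Pi.smul_apply, Pi.single_apply,
    Fin.ext_iff, smul_eq_mul, Fin.val_last]
  split_ifs <;> omega

/-- The weight functional `v ↦ ∑ v_i 2^i`. -/
def wt (m : ℕ) : (Fin (m + 1) → ℤ) →ₗ[ℤ] ℤ :=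
  ∑ i : Fin (m + 1), (2 ^ (i : ℕ) : ℤ) • LinearMap.proj i

lemma wt_apply (m : ℕ) (v : Fin (m + 1) → ℤ) : wt m v = ∑ i, v i * 2 ^ (i : ℕ) := by
  simp [wt, mul_comm]

lemma wt_single (m : ℕ) (i : Fin (m + 1)) : wt m (Pi.single i 1) = 2 ^ (i : ℕ) := by
  simp [wt_apply, Pi.single_apply]

lemma span_eq (m p : ℕ) (b : Fin (m + 1) → ℤ)
    (hs : ∑ i, b i * 2 ^ (i : ℕ) = 2 ^ (m + 1) - (p : ℤ)) (v : Fin (m + 1) → ℤ) :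
    v ∈ Submodule.span ℤ (Set.range (theMat m b).transpose) ↔ (p : ℤ) ∣ wt m v := by
  set S := Submodule.span ℤ (Set.range (theMat m b).transpose) with hS
  have hcol : ∀ j, (theMat m b).transpose j ∈ S := fun j => Submodule.subset_span ⟨j, rfl⟩
  constructor
  · intro hv
    induction hv using Submodule.span_induction with
    | mem x hx =>
      obtain ⟨j, rfl⟩ := hx
      by_cases hj : (j : ℕ) < m
      · have := theMat_col_lt m b j hj
        simp only [Fin.eta] at this
        rw [this, map_sub, map_smul, wt_single, wt_single]
        simp [pow_succ, mul_comm]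
      · have : j = Fin.last m := by ext; simp; omega
        rw [this, theMat_col_last, map_sub, map_smul, wt_single, wt_apply, hs]
        simp [pow_succ, mul_comm]
    | zero => simp
    | add x y _ _ hx hy => rw [map_add]; exact dvd_add hx hy
    | smul a x _ hx => rw [map_smul]; exact Dvd.dvd.mul_left hx a
  · have hpow : ∀ j (hj : j < m + 1),
        (Pi.single ⟨j, hj⟩ 1 : Fin (m + 1) → ℤ) - (2 ^ j : ℤ) • Pi.single 0 1 ∈ S := by
      intro j
      induction j with
      | zero => intro hj; simp
      | succ j ih =>
        intro hj
        have h1 := ih (by omega)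
        have h2 := hcol ⟨j, by omega⟩
        rw [theMat_col_lt m b j (by omega)] at h2
        have h3 := S.sub_mem (S.smul_mem 2 h1) h2
        convert h3 using 1
        rw [pow_succ]
        module
    have hred : ∀ v : Fin (m + 1) → ℤ, v - (wt m v) • Pi.single 0 1 ∈ S := by
      intro v
      have : v - (wt m v) • Pi.single 0 1 =
          ∑ i, v i • ((Pi.single i 1 : Fin (m + 1) → ℤ) - (2 ^ (i : ℕ) : ℤ) • Pi.single 0 1) := by
        simp only [smul_sub, Finset.sum_sub_distrib, smul_smul]
        rw [← Finset.sum_smul, ← wt_apply]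
        congr 1
        exact pi_eq_sum_univ' v
      rw [this]
      exact S.sum_mem fun i _ => S.smul_mem _ (hpow i i.2)
    have hp0 : (p : ℤ) • (Pi.single 0 1 : Fin (m + 1) → ℤ) ∈ S := by
      have h1 := hred ((theMat m b).transpose (Fin.last m))
      have h2 := S.sub_mem (hcol (Fin.last m)) h1
      have h3 : wt m ((theMat m b).transpose (Fin.last m)) = p := by
        rw [theMat_col_last, map_sub, map_smul, wt_single, wt_apply, hs]
        simp [pow_succ, mul_comm]
      rw [h3] at h2
      simpa using h2
    rintro ⟨c, hc⟩
    have h1 := S.add_mem (hred v) (S.smul_mem c hp0)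
    rw [hc, smul_smul, mul_comm c] at h1
    simpa using h1

/-- For every `1 ≤ p ≤ 2 ^ n` there is an `n × n` integer matrix, all of whose rows are of
type 1–9, whose cokernel `ℤ^n / ⟨columns of M⟩` is the cyclic group `ℤ/pℤ`. -/
theorem cyclic_group_realizable (n : ℕ) (hn : 1 ≤ n) (p : ℕ) (hp : 1 ≤ p)
    (hp2 : p ≤ 2 ^ n) :
    ∃ M : Matrix (Fin n) (Fin n) ℤ, (∀ i : Fin n, IsType19 (M i)) ∧
      Nonempty (((Fin n → ℤ) ⧸ Submodule.span ℤ (Set.range M.transpose)) ≃+ ZMod p) := by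
  obtain ⟨m, rfl⟩ : ∃ m, n = m + 1 := ⟨n - 1, by omega⟩
  obtain ⟨b, hb, hs⟩ := exists_bits (m + 1) (2 ^ (m + 1) - p) (by omega)
  rw [Nat.cast_sub hp2] at hs
  push_cast at hs
  refine ⟨theMat m b, theMat_type m b hb, ?_⟩
  let φ : (Fin (m + 1) → ℤ) →ₗ[ℤ] ZMod p :=
    ((Int.castAddHom (ZMod p)).toIntLinearMap).comp (wt m)
  have hφ : ∀ v, φ v = ((wt m v : ℤ) : ZMod p) := fun v => rfl
  have hsurj : Function.Surjective φ := by
    intro z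
    obtain ⟨a, rfl⟩ := ZMod.intCast_surjective z
    refine ⟨a • Pi.single 0 1, ?_⟩
    rw [hφ, map_smul, wt_single]
    simp
  have hker : Submodule.span ℤ (Set.range (theMat m b).transpose) = LinearMap.ker φ := by
    ext v
    rw [span_eq m p b hs, LinearMap.mem_ker, hφ, ZMod.intCast_zmod_eq_zero_iff_dvd]
  exact ⟨((Submodule.quotEquivOfEq _ _ hker).trans
    (φ.quotKerEquivOfSurjective hsurj)).toAddEquiv⟩
end

section
/- Let n ≥ 1, let b_1, …, b_n ∈ {0,1}, and set q = Σ_{i=1}^n b_i·2^{n−i}. Define the n×n integer matrix M by: M_{11} = 2 − b_1; M_{i1} = −b_i for 2 ≤ i ≤ n; M_{ii} = 2 for 2 ≤ i ≤ n; M_{i,i+1} = −1 for 1 ≤ i ≤ n−1; and all other entries zero. Then det M = 2^n − q. -/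
/-- Bidiagonal matrix with an arbitrary first column. -/
theorem det_bidiag_aux (n : ℕ) : ∀ c : Fin (n + 1) → ℤ,
    (Matrix.of fun i j : Fin (n + 1) =>
        if (j : ℕ) = 0 then c i
        else if (j : ℕ) = (i : ℕ) + 1 then -1
        else if i = j then 2
        else 0).det = ∑ i : Fin (n + 1), c i * 2 ^ (n - (i : ℕ)) := by
  induction n with
  | zero => intro c; simp
  | succ n ih =>
    intro c
    rw [Matrix.det_succ_row_zero, Fin.sum_univ_succ, Fin.sum_univ_succ]
    rw [Finset.sum_eq_zero (s := Finset.univ (α := Fin n))]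
    · have h0 := ih (fun i => if i = 0 then 2 else 0)
      have h1 := ih (fun i => c i.succ)
      have e0 : ((Matrix.of fun i j : Fin (n + 1 + 1) =>
          if (j : ℕ) = 0 then c i
          else if (j : ℕ) = (i : ℕ) + 1 then -1
          else if i = j then (2 : ℤ)
          else 0).submatrix Fin.succ (Fin.succAbove 0)) = (Matrix.of fun i j : Fin (n + 1) =>
          if (j : ℕ) = 0 then (if i = 0 then 2 else 0)
          else if (j : ℕ) = (i : ℕ) + 1 then -1
          else if i = j then 2
          else 0) := by
        ext i j
        simp only [Matrix.submatrix_apply, Matrix.of_apply, Fin.succAbove_zero, Fin.val_succ,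
          Fin.ext_iff, Fin.val_zero]
        rw [if_neg (Nat.succ_ne_zero _)]
        split_ifs <;> first | rfl | omega
      have e1 : ((Matrix.of fun i j : Fin (n + 1 + 1) =>
          if (j : ℕ) = 0 then c i
          else if (j : ℕ) = (i : ℕ) + 1 then -1
          else if i = j then (2 : ℤ)
          else 0).submatrix Fin.succ (Fin.succAbove (Fin.succ 0))) =
          (Matrix.of fun i j : Fin (n + 1) =>
          if (j : ℕ) = 0 then c i.succ
          else if (j : ℕ) = (i : ℕ) + 1 then -1
          else if i = j then 2
          else 0) := by
        ext i j
        refine Fin.cases ?_ (fun k => ?_) j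
        · simp
        · simp only [Matrix.submatrix_apply, Matrix.of_apply, Fin.succ_succAbove_succ,
            Fin.succAbove_zero, Fin.val_succ, Fin.ext_iff]
          split_ifs <;> first | rfl | omega
      rw [e0, e1, h0, h1, Fin.sum_univ_succ (n := n + 1)]
      rw [Fin.sum_univ_succ (n := n)]
      simp [Fin.succ_ne_zero]
      left
      ring
    · intro i _
      have h : (Matrix.of fun i j : Fin (n + 1 + 1) =>
          if (j : ℕ) = 0 then c i
          else if (j : ℕ) = (i : ℕ) + 1 then -1
          else if i = j then (2 : ℤ)
          else 0) 0 i.succ.succ = 0 := by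
        rw [Matrix.of_apply, if_neg (by simp), if_neg (by simp),
          if_neg (Fin.succ_ne_zero _).symm]
      rw [h, mul_zero, zero_mul]

/-- Let `b_1, …, b_n ∈ {0,1}` and `q = Σ b_i·2^{n−i}` (most significant digit first).
The `n × n` matrix with first column `(2 − b_1, −b_2, …, −b_n)ᵀ`, with `2` on the
remaining diagonal entries, `−1` on the superdiagonal and zeros elsewhere has
determinant `2^n − q`. -/
theorem det_binary_matrix (n : ℕ) (hn : 1 ≤ n) (b : Fin n → ℤ)
    (hb : ∀ i, b i = 0 ∨ b i = 1) (q : ℤ)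
    (hq : q = ∑ i : Fin n, b i * 2 ^ (n - 1 - (i : ℕ))) :
    (Matrix.of fun i j : Fin n =>
        if (j : ℕ) = 0 then (if (i : ℕ) = 0 then 2 - b i else -b i)
        else if (j : ℕ) = (i : ℕ) + 1 then -1
        else if i = j then 2
        else 0).det = 2 ^ n - q := by
  obtain ⟨m, rfl⟩ : ∃ m, n = m + 1 := ⟨n - 1, by omega⟩
  have h := det_bidiag_aux m (fun i => if (i : ℕ) = 0 then 2 - b i else -b i)
  rw [h, hq, Fin.sum_univ_succ, Fin.sum_univ_succ]
  simp only [Fin.val_zero, Fin.val_succ, if_true, Nat.add_sub_cancel, Nat.succ_ne_zero, if_false,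
    neg_mul, Finset.sum_neg_distrib, Nat.sub_zero, pow_succ]
  ring
end

section
/- Let n ≥ 1, let n = n_1 + n_2 + … + n_k be a partition of n into positive integers, and let p_1, …, p_k be integers with 1 ≤ p_i ≤ 2^{n_i} for each i. Then there exists an n×n integer matrix M, all of whose rows are of type 1–9, such that the cokernel of M — the quotient of the additive group ℤ^n by the subgroup generated by the columns of M — is isomorphic as an additive group to the direct product (ℤ/p_1ℤ) × (ℤ/p_2ℤ) × … × (ℤ/p_kℤ). -/
theorem type19_of_inj {n : ℕ} {ι : Type*} (e : Fin n ≃ ι) (l : List ℤ)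
    (hl : l ∈ ([[1], [2], [1, 1], [1, -1], [2, -1], [1, 1, -1], [2, -2], [2, -1, -1],
      [1, 1, -1, -1]] : List (List ℤ)))
    (f : Fin l.length → ι) (hf : Function.Injective f) (y : ι → ℤ)
    (h1 : ∀ a, y (f a) = l.getD (a : ℕ) 0) (h2 : ∀ k, (∀ a, k ≠ f a) → y k = 0) :
    IsType19 (fun k => y (e k)) := by
  classical
  have hg : Function.Injective (fun a => e.symm (f a)) := e.symm.injective.comp hf
  have hle : l.length ≤ n := by
    simpa using Fintype.card_le_of_injective _ hg
  refine ⟨l, hl, hle, 1, Or.inl rfl, ?_⟩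
  let E : {i : Fin n // i.val < l.length} ≃ {i : Fin n // i ∈ Set.range (fun a => e.symm (f a))} :=
    Equiv.trans ⟨fun i => ⟨i.1.1, i.2⟩, fun a => ⟨⟨a.1, by omega⟩, a.2⟩,
      fun _ => rfl, fun _ => rfl⟩ (Equiv.ofInjective _ hg)
  refine ⟨E.extendSubtype, fun i => ?_⟩
  change y (e (E.extendSubtype i)) = _
  by_cases hi : i.val < l.length
  · rw [Equiv.extendSubtype_apply_of_mem E i hi]
    have : ((E ⟨i, hi⟩ : _) : Fin n) = e.symm (f ⟨i, hi⟩) := rfl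
    rw [this, Equiv.apply_symm_apply, h1, one_mul]
  · have h := Equiv.extendSubtype_not_mem E i hi
    rw [h2, List.getD_eq_default _ _ (by omega), mul_zero]
    intro a ha
    exact h ⟨a, by simp [← ha]⟩

theorem type19_one {n : ℕ} {ι : Type*} (e : Fin n ≃ ι) (u : ℤ)
    (hl : u = 1 ∨ u = 2) (a : ι) (y : ι → ℤ)
    (ha : y a = u) (h2 : ∀ k, k ≠ a → y k = 0) :
    IsType19 (fun k => y (e k)) := by
  refine type19_of_inj e [u] (by rcases hl with rfl | rfl <;> simp) ![a] ?_ y ?_ ?_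
  · intro i j _
    exact Subsingleton.elim (α := Fin 1) i j
  · intro i
    fin_cases i
    simpa using ha
  · intro k hk
    exact h2 k (hk (0 : Fin 1))

theorem type19_two {n : ℕ} {ι : Type*} (e : Fin n ≃ ι) (u : ℤ)
    (hl : u = 1 ∨ u = 2) (a b : ι) (hab : a ≠ b) (y : ι → ℤ)
    (ha : y a = u) (hb : y b = -1) (h2 : ∀ k, k ≠ a → k ≠ b → y k = 0) :
    IsType19 (fun k => y (e k)) := by
  refine type19_of_inj e [u, -1] (by rcases hl with rfl | rfl <;> simp) ![a, b] ?_ y ?_ ?_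
  · intro i j hij
    fin_cases i <;> fin_cases j <;> simp_all
  · intro i
    fin_cases i
    · simpa using ha
    · simpa using hb
  · intro k hk
    exact h2 k (hk (0 : Fin 2)) (hk (1 : Fin 2))

theorem type19_three {n : ℕ} {ι : Type*} (e : Fin n ≃ ι)
    (a b c : ι) (hab : a ≠ b) (hac : a ≠ c) (hbc : b ≠ c) (y : ι → ℤ)
    (ha : y a = 2) (hb : y b = -1) (hc : y c = -1)
    (h2 : ∀ k, k ≠ a → k ≠ b → k ≠ c → y k = 0) :
    IsType19 (fun k => y (e k)) := by
  refine type19_of_inj e [2, -1, -1] (by simp) ![a, b, c] ?_ y ?_ ?_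
  · intro i j hij
    fin_cases i <;> fin_cases j <;> simp_all
  · intro i
    fin_cases i
    · simpa using ha
    · simpa using hb
    · simpa using hc
  · intro k hk
    exact h2 k (hk (0 : Fin 3)) (hk (1 : Fin 3)) (hk (2 : Fin 3))

theorem sum_testBit (m : ℕ) : ∀ c : ℕ, c < 2 ^ m →
    ∑ j : Fin m, (if c.testBit j then (2 : ℤ) ^ (j : ℕ) else 0) = c := by
  induction m with
  | zero => intro c hc; simp at hc; simp [hc]
  | succ m ih =>
    intro c hc
    rw [Fin.sum_univ_succ]
    have h := ih (c / 2) (by rw [pow_succ] at hc; omega)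
    have h' : ∑ j : Fin m, (if c.testBit (j.succ : Fin (m+1)) then
        (2 : ℤ) ^ ((j.succ : Fin (m+1)) : ℕ) else 0) = 2 * ((c / 2 : ℕ) : ℤ) := by
      rw [← h, Finset.mul_sum]
      refine Finset.sum_congr rfl fun j _ => ?_
      rw [Fin.val_succ, Nat.testBit_succ, pow_succ]
      split_ifs <;> ring
    rw [h']
    simp only [Fin.val_zero, Nat.testBit_zero, pow_zero, decide_eq_true_eq]
    split_ifs <;> omega

/-- The block-diagonal matrix. -/
def blockM {k : ℕ} (nn : Fin k → ℕ) (B : Fin k → ℕ → Bool)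
    (x y : Σ i, Fin (nn i)) : ℤ :=
  if x.1 = y.1 then
    (if x.2.val = y.2.val then 2 else 0) - (if x.2.val = y.2.val + 1 then 1 else 0)
      - (if y.2.val + 1 = nn y.1 ∧ B x.1 x.2.val = true then 1 else 0)
  else 0

theorem blockM_type {n k : ℕ} (nn : Fin k → ℕ) (B : Fin k → ℕ → Bool)
    (e : Fin n ≃ Σ i, Fin (nn i)) (x : Σ i, Fin (nn i)) :
    IsType19 (fun j => blockM nn B x (e j)) := by
  obtain ⟨i, j, hj⟩ := x
  have key : ∀ (a b : ℕ) (ha : a < nn i) (hb : b < nn i),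
    ((⟨i, ⟨a, ha⟩⟩ : Σ i, Fin (nn i)) = ⟨i, ⟨b, hb⟩⟩) ↔ a = b := by
    intro a b ha hb; simp
  have val : ∀ (a : ℕ) (ha : a < nn i), blockM nn B ⟨i, ⟨j, hj⟩⟩ ⟨i, ⟨a, ha⟩⟩ =
      (if j = a then 2 else 0) - (if j = a + 1 then 1 else 0)
      - (if a + 1 = nn i ∧ B i j = true then 1 else 0) := by
    intro a ha; simp [blockM]
  have zero : ∀ z : (Σ i, Fin (nn i)), (∀ (a : ℕ) (ha : a < nn i), z = ⟨i, ⟨a, ha⟩⟩ →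
      (if j = a then (2 : ℤ) else 0) - (if j = a + 1 then 1 else 0)
      - (if a + 1 = nn i ∧ B i j = true then 1 else 0) = 0) →
      blockM nn B ⟨i, ⟨j, hj⟩⟩ z = 0 := by
    rintro ⟨i', a, ha⟩ h
    by_cases hi : i = i'
    · subst hi
      rw [val]
      exact h a ha rfl
    · simp [blockM, hi]
  rcases hB : B i j with _ | _
  · simp only [hB] at val zero
    rcases Nat.eq_zero_or_pos j with h0 | h0
    · refine type19_one e 2 (Or.inr rfl) ⟨i, ⟨j, hj⟩⟩ _ ?_ ?_
      · rw [val]; simp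
      · intro z hz
        refine zero z fun a ha hza => ?_
        rw [hza, Ne, key] at hz
        simp; omega
    · refine type19_two e 2 (Or.inr rfl) ⟨i, ⟨j, hj⟩⟩ ⟨i, ⟨j - 1, by omega⟩⟩ ?_ _ ?_ ?_ ?_
      · rw [Ne, key]; omega
      · rw [val]; simp
      · rw [val]; simp; omega
      · intro z hz hz'
        refine zero z fun a ha hza => ?_
        rw [hza, Ne, key] at hz hz'
        simp; omega
  · simp only [hB, and_true] at val zero
    rcases Nat.eq_zero_or_pos j with h0 | h0
    · by_cases hL : j + 1 = nn i
      · refine type19_one e 1 (Or.inl rfl) ⟨i, ⟨j, hj⟩⟩ _ ?_ ?_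
        · rw [val]; split_ifs <;> omega
        · intro z hz
          refine zero z fun a ha hza => ?_
          rw [hza, Ne, key] at hz
          omega
      · refine type19_two e 2 (Or.inr rfl) ⟨i, ⟨j, hj⟩⟩ ⟨i, ⟨nn i - 1, by omega⟩⟩ ?_ _ ?_ ?_ ?_
        · rw [Ne, key]; omega
        · rw [val]; split_ifs <;> omega
        · rw [val]; split_ifs <;> omega
        · intro z hz hz'
          refine zero z fun a ha hza => ?_
          rw [hza, Ne, key] at hz hz'
          split_ifs <;> omega
    · by_cases hL : j + 1 = nn i
      · refine type19_two e 1 (Or.inl rfl) ⟨i, ⟨j, hj⟩⟩ ⟨i, ⟨j - 1, by omega⟩⟩ ?_ _ ?_ ?_ ?_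
        · rw [Ne, key]; omega
        · rw [val]; split_ifs <;> omega
        · rw [val]; split_ifs <;> omega
        · intro z hz hz'
          refine zero z fun a ha hza => ?_
          rw [hza, Ne, key] at hz hz'
          split_ifs <;> omega
      · refine type19_three e ⟨i, ⟨j, hj⟩⟩ ⟨i, ⟨j - 1, by omega⟩⟩ ⟨i, ⟨nn i - 1, by omega⟩⟩
          ?_ ?_ ?_ _ ?_ ?_ ?_ ?_
        · rw [Ne, key]; omega
        · rw [Ne, key]; omega
        · rw [Ne, key]; omega
        · rw [val]; split_ifs <;> omega
        · rw [val]; split_ifs <;> omega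
        · rw [val]; split_ifs <;> omega
        · intro z hz hz' hz''
          refine zero z fun a ha hza => ?_
          rw [hza, Ne, key] at hz hz' hz''
          split_ifs <;> omega

/-- Weighted sums: for any family `g` of elements of an abelian group with `g i j = 2 ^ j • g0 i`,
the sum of `g` against column `y` of the block matrix. -/
theorem blockM_col {k : ℕ} (nn : Fin k → ℕ) (p : Fin k → ℕ)
    (hp : ∀ i, 1 ≤ p i) (hp2 : ∀ i, p i ≤ 2 ^ nn i) (i : Fin k) (b : Fin (nn i)) :
    ∑ a : Fin (nn i), blockM nn (fun i j => (2 ^ nn i - p i).testBit j) ⟨i, a⟩ ⟨i, b⟩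
      * (2 : ℤ) ^ (a : ℕ) = if b.val + 1 = nn i then (p i : ℤ) else 0 := by
  have hc := sum_testBit (nn i) (2 ^ nn i - p i) (by
    have := hp i; have := Nat.two_pow_pos (nn i); omega)
  simp only [blockM, if_true, sub_mul, Finset.sum_sub_distrib, ite_mul, zero_mul, one_mul]
  have e1 : ∑ a : Fin (nn i), (if a.val = b.val then 2 * (2 : ℤ) ^ a.val else 0)
      = 2 * 2 ^ b.val := by
    simp [← Fin.ext_iff]
  rw [e1]
  by_cases hL : b.val + 1 = nn i
  · have e2 : ∑ a : Fin (nn i), (if a.val = b.val + 1 then (2 : ℤ) ^ a.val else 0) = 0 := by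
      refine Finset.sum_eq_zero fun a _ => ?_
      rw [if_neg]; omega
    rw [e2]
    simp only [hL, true_and, if_true]
    rw [hc, Nat.cast_sub (hp2 i)]
    have : (2 : ℤ) * 2 ^ b.val = 2 ^ nn i := by
      rw [← pow_succ']; exact congrArg _ hL
    push_cast
    rw [this]; ring
  · have e2 : ∑ a : Fin (nn i), (if a.val = b.val + 1 then (2 : ℤ) ^ a.val else 0)
        = 2 ^ (b.val + 1) := by
      rw [Finset.sum_eq_single (⟨b.val + 1, by omega⟩ : Fin (nn i))]
      · simp
      · intro a _ ha
        rw [if_neg]; intro h; exact ha (Fin.ext h)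
      · simp
    rw [e2]
    simp [hL, pow_succ]; ring

theorem main_sigma {k : ℕ} (nn : Fin k → ℕ) (hnn : ∀ i, 1 ≤ nn i)
    (p : Fin k → ℕ) (hp : ∀ i, 1 ≤ p i) (hp2 : ∀ i, p i ≤ 2 ^ nn i)
    {n : ℕ} (e : Fin n ≃ Σ i, Fin (nn i)) (M : Matrix (Fin n) (Fin n) ℤ)
    (hM : M = fun a b => blockM nn (fun i j => (2 ^ nn i - p i).testBit j) (e a) (e b)) :
    Nonempty (((Fin n → ℤ) ⧸ Submodule.span ℤ (Set.range M.transpose)) ≃+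
        (∀ i : Fin k, ZMod (p i))) := by
  classical
  set B : Fin k → ℕ → Bool := (fun i j => (2 ^ nn i - p i).testBit j) with hBdef
  let φ : (Fin n → ℤ) →ₗ[ℤ] (∀ i : Fin k, ZMod (p i)) := AddMonoidHom.toIntLinearMap
    { toFun := fun x i => ((∑ j : Fin (nn i), x (e.symm ⟨i, j⟩) * 2 ^ (j : ℕ) : ℤ) : ZMod (p i))
      map_zero' := by ext i; simp
      map_add' := by
        intro x y; ext i
        simp [add_mul, Finset.sum_add_distrib] }
  have hφ : ∀ x i, φ x i =
    ((∑ j : Fin (nn i), x (e.symm ⟨i, j⟩) * 2 ^ (j : ℕ) : ℤ) : ZMod (p i)) := fun _ _ => rfl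
  have hsurj : Function.Surjective φ := by
    intro z
    choose w hw using fun i => ZMod.intCast_surjective (z i)
    let W : (Σ i, Fin (nn i)) → ℤ := fun y => if y.2.val = 0 then w y.1 else 0
    refine ⟨fun t => W (e t), ?_⟩
    ext i
    rw [hφ, ← hw i]
    congr 1
    simp only [Equiv.apply_symm_apply]
    rw [Finset.sum_eq_single (⟨0, hnn i⟩ : Fin (nn i))]
    · simp [W]
    · intro a _ ha
      have : a.val ≠ 0 := fun h => ha (Fin.ext h)
      simp [W, this]
    · simp
  set S := Submodule.span ℤ (Set.range M.transpose) with hS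
  have hMt : ∀ b a, M.transpose b a = blockM nn B (e a) (e b) := by
    intro b a; rw [hM]; rfl
  have hcolmem : ∀ y : (Σ i, Fin (nn i)),
      (fun t => blockM nn B (e t) y) ∈ S := by
    intro y
    refine Submodule.subset_span ⟨e.symm y, ?_⟩
    ext a; rw [hMt]; simp
  have hle : S ≤ LinearMap.ker φ := by
    rw [hS, Submodule.span_le]
    rintro _ ⟨b, rfl⟩
    rw [SetLike.mem_coe, LinearMap.mem_ker]
    ext i
    rw [hφ]
    simp only [hMt, Equiv.apply_symm_apply]
    obtain ⟨⟨i', c⟩, rfl⟩ := e.symm.surjective b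
    rw [Equiv.apply_symm_apply]
    by_cases hi : i = i'
    · subst hi
      rw [hBdef, blockM_col nn p hp hp2]
      split_ifs <;> simp
    · simp [blockM, hi]
  -- generators in the quotient
  let E : (Σ i, Fin (nn i)) → ((Fin n → ℤ) ⧸ S) :=
    fun y => S.mkQ (Pi.single (e.symm y) 1)
  have hexp : ∀ x : Fin n → ℤ, S.mkQ x =
      ∑ i : Fin k, ∑ j : Fin (nn i), x (e.symm ⟨i, j⟩) • E ⟨i, j⟩ := by
    intro x
    have h1 : x = ∑ t : Fin n, x t • (Pi.single t 1 : Fin n → ℤ) := by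
      ext s; simp [Finset.sum_apply, Pi.single_apply]
    conv_lhs => rw [h1]
    rw [map_sum, ← Equiv.sum_comp e.symm, ← Finset.univ_sigma_univ, Finset.sum_sigma]
    simp only [map_smul]
    rfl
  have hcol : ∀ (i : Fin k) (b : Fin (nn i)),
      ∑ j : Fin (nn i), blockM nn B ⟨i, j⟩ ⟨i, b⟩ • E ⟨i, j⟩ = 0 := by
    intro i b
    have h := (Submodule.Quotient.mk_eq_zero S).2 (hcolmem ⟨i, b⟩)
    rw [← Submodule.mkQ_apply, hexp, Finset.sum_eq_single i] at h
    · simpa using h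
    · intro i' _ hi'
      simp [blockM, hi']
    · simp
  have hstep : ∀ (i : Fin k) (j : ℕ) (hj : j + 1 < nn i),
      E ⟨i, ⟨j + 1, hj⟩⟩ = (2 : ℤ) • E ⟨i, ⟨j, by omega⟩⟩ := by
    intro i j hj
    have h := hcol i ⟨j, by omega⟩
    have hne : j + 1 ≠ nn i := by omega
    simp only [blockM, if_true, hne, false_and, if_false, sub_zero, sub_smul,
      Finset.sum_sub_distrib, ite_smul, zero_smul, one_smul] at h
    rw [Finset.sum_eq_single (⟨j, by omega⟩ : Fin (nn i)),
      Finset.sum_eq_single (⟨j + 1, hj⟩ : Fin (nn i))] at h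
    · simp only [if_true] at h
      exact (sub_eq_zero.1 h).symm
    · intro a _ ha
      rw [if_neg]; intro h; exact ha (Fin.ext h)
    · simp
    · intro a _ ha
      rw [if_neg]; intro h; exact ha (Fin.ext h)
    · simp
  have hpow : ∀ (i : Fin k) (j : ℕ) (hj : j < nn i),
      E ⟨i, ⟨j, hj⟩⟩ = ((2 : ℤ) ^ j) • E ⟨i, ⟨0, hnn i⟩⟩ := by
    intro i j
    induction j with
    | zero => intro hj; simp
    | succ j ih =>
      intro hj
      rw [hstep i j hj, ih (by omega), smul_smul, pow_succ, mul_comm]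
  have hsumE : ∀ (i : Fin k) (f : Fin (nn i) → ℤ), ∑ j, f j • E ⟨i, j⟩ =
      (∑ j, f j * 2 ^ (j : ℕ)) • E ⟨i, ⟨0, hnn i⟩⟩ := by
    intro i f
    rw [Finset.sum_smul]
    refine Finset.sum_congr rfl fun j _ => ?_
    rw [mul_smul, ← hpow i j.val j.2]
  have hpE : ∀ i, (p i : ℤ) • E ⟨i, ⟨0, hnn i⟩⟩ = 0 := by
    intro i
    have h := hcol i ⟨nn i - 1, by have := hnn i; omega⟩
    rw [hsumE, hBdef, blockM_col nn p hp hp2, if_pos (by have := hnn i; simp; omega)] at h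
    exact h
  have hge : LinearMap.ker φ ≤ S := by
    intro x hx
    rw [LinearMap.mem_ker] at hx
    rw [← Submodule.Quotient.mk_eq_zero, ← Submodule.mkQ_apply, hexp]
    refine Finset.sum_eq_zero fun i _ => ?_
    rw [hsumE]
    have hi := congrFun hx i
    rw [hφ, Pi.zero_apply, ZMod.intCast_zmod_eq_zero_iff_dvd _ _] at hi
    obtain ⟨q, hq⟩ := hi
    rw [hq, mul_comm, mul_smul, hpE, smul_zero]
  have hker : S = LinearMap.ker φ := le_antisymm hle hge
  exact ⟨((Submodule.quotEquivOfEq _ _ hker).trans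
    (φ.quotKerEquivOfSurjective hsurj)).toAddEquiv⟩

/-- For every partition `n = n_1 + ⋯ + n_k` of `n ≥ 1` into positive integers and every
choice of `1 ≤ p_i ≤ 2 ^ n_i`, there is an `n × n` integer matrix, all of whose rows are
of type 1–9, whose cokernel `ℤ^n / ⟨columns of M⟩` is `ℤ/p_1ℤ × ⋯ × ℤ/p_kℤ`. -/
theorem product_of_cyclic_groups_realizable (n k : ℕ) (hn : 1 ≤ n)
    (nn : Fin k → ℕ) (hnn : ∀ i, 1 ≤ nn i) (hsum : ∑ i, nn i = n)
    (p : Fin k → ℕ) (hp : ∀ i, 1 ≤ p i) (hp2 : ∀ i, p i ≤ 2 ^ nn i) :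
    ∃ M : Matrix (Fin n) (Fin n) ℤ, (∀ i : Fin n, IsType19 (M i)) ∧
      Nonempty (((Fin n → ℤ) ⧸ Submodule.span ℤ (Set.range M.transpose)) ≃+
        (∀ i : Fin k, ZMod (p i))) := by
  have e : Fin n ≃ Σ i, Fin (nn i) := (finCongr hsum.symm).trans finSigmaFinEquiv.symm
  refine ⟨fun a b => blockM nn (fun i j => (2 ^ nn i - p i).testBit j) (e a) (e b),
    fun i => blockM_type nn _ e (e i), main_sigma nn hnn p hp hp2 e _ rfl⟩
end

section
/- Let θ_1, θ_2, θ_3 ∈ ℝ. Then the three numbers 2θ_2 − θ_1 − θ_3, 2θ_3 − θ_1 − θ_2, and 2θ_1 − θ_2 − θ_3 all lie in 2πℤ if and only if there exist c ∈ ℝ and k ∈ ℤ such that θ_1 ≡ c, θ_2 ≡ c + 2πk/3, and θ_3 ≡ c + 4πk/3, all modulo 2π. -/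
/-- The phase rotations `diag(e^{iθ_1}, e^{iθ_2}, e^{iθ_3})` leaving the `ℤ_3`-symmetric
terms of the 3HDM potential invariant: `2θ_2 − θ_1 − θ_3`, `2θ_3 − θ_1 − θ_2` and
`2θ_1 − θ_2 − θ_3` all lie in `2πℤ` iff modulo `2π` the phases are
`θ_1 ≡ c`, `θ_2 ≡ c + 2πk/3`, `θ_3 ≡ c + 4πk/3` for some `c ∈ ℝ` and `k ∈ ℤ`. -/
theorem Z3_symmetry_phase_condition (θ₁ θ₂ θ₃ : ℝ) :
    ((∃ k : ℤ, 2 * θ₂ - θ₁ - θ₃ = 2 * Real.pi * k) ∧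
     (∃ k : ℤ, 2 * θ₃ - θ₁ - θ₂ = 2 * Real.pi * k) ∧
     (∃ k : ℤ, 2 * θ₁ - θ₂ - θ₃ = 2 * Real.pi * k)) ↔
    (∃ c : ℝ, ∃ k : ℤ,
      (∃ m : ℤ, θ₁ - c = 2 * Real.pi * m) ∧
      (∃ m : ℤ, θ₂ - (c + 2 * Real.pi * k / 3) = 2 * Real.pi * m) ∧
      (∃ m : ℤ, θ₃ - (c + 4 * Real.pi * k / 3) = 2 * Real.pi * m)) := by
  constructor
  · rintro ⟨⟨p, hp⟩, ⟨q, hq⟩, -⟩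
    refine ⟨θ₁, 2 * p + q, ⟨0, ?_⟩, ⟨0, ?_⟩, ⟨-p, ?_⟩⟩ <;> push_cast <;> linarith
  · rintro ⟨c, k, ⟨a, ha⟩, ⟨b, hb⟩, ⟨d, hd⟩⟩
    refine ⟨⟨2 * b - a - d, ?_⟩, ⟨k + 2 * d - a - b, ?_⟩, ⟨-k + 2 * a - b - d, ?_⟩⟩ <;>
      push_cast <;> linarith
end

section
/- Let θ_1, θ_2, θ_3, θ_4 ∈ ℝ. Then the three numbers 2θ_1 − θ_3 − θ_4, 2θ_3 − θ_2 − θ_4, and 2θ_2 − θ_1 − θ_4 all lie in 2πℤ if and only if there exist c ∈ ℝ and k ∈ ℤ such that θ_1 ≡ c, θ_2 ≡ c + 2πk·(2/7), θ_3 ≡ c + 2πk·(3/7), and θ_4 ≡ c + 2πk·(4/7), all modulo 2π. -/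
/-- The phase rotations `diag(e^{iθ_1}, …, e^{iθ_4})` leaving the `ℤ_7`-symmetric terms of
the 4HDM potential invariant: `2θ_1 − θ_3 − θ_4`, `2θ_3 − θ_2 − θ_4` and
`2θ_2 − θ_1 − θ_4` all lie in `2πℤ` iff modulo `2π` the phases are
`θ_1 ≡ c`, `θ_2 ≡ c + 2πk·(2/7)`, `θ_3 ≡ c + 2πk·(3/7)`, `θ_4 ≡ c + 2πk·(4/7)`
for some `c ∈ ℝ` and `k ∈ ℤ`. -/
theorem Z7_symmetry_phase_condition (θ₁ θ₂ θ₃ θ₄ : ℝ) :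
    ((∃ k : ℤ, 2 * θ₁ - θ₃ - θ₄ = 2 * Real.pi * k) ∧
     (∃ k : ℤ, 2 * θ₃ - θ₂ - θ₄ = 2 * Real.pi * k) ∧
     (∃ k : ℤ, 2 * θ₂ - θ₁ - θ₄ = 2 * Real.pi * k)) ↔
    (∃ c : ℝ, ∃ k : ℤ,
      (∃ m : ℤ, θ₁ - c = 2 * Real.pi * m) ∧
      (∃ m : ℤ, θ₂ - (c + 2 * Real.pi * k * (2 / 7)) = 2 * Real.pi * m) ∧
      (∃ m : ℤ, θ₃ - (c + 2 * Real.pi * k * (3 / 7)) = 2 * Real.pi * m) ∧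
      (∃ m : ℤ, θ₄ - (c + 2 * Real.pi * k * (4 / 7)) = 2 * Real.pi * m)) := by
  constructor
  · rintro ⟨⟨a, ha⟩, ⟨b, hb⟩, ⟨d, hd⟩⟩
    refine ⟨θ₁, 5 * d - a + 3 * b, ⟨0, by simp⟩, ⟨-d - b, ?_⟩, ⟨-2 * d - b, ?_⟩,
      ⟨-3 * d - 2 * b, ?_⟩⟩ <;> push_cast <;> linarith
  · rintro ⟨c, k, ⟨m₁, h₁⟩, ⟨m₂, h₂⟩, ⟨m₃, h₃⟩, ⟨m₄, h₄⟩⟩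
    refine ⟨⟨2 * m₁ - m₃ - m₄ - k, ?_⟩, ⟨2 * m₃ - m₂ - m₄, ?_⟩, ⟨2 * m₂ - m₁ - m₄, ?_⟩⟩ <;>
      push_cast <;> linarith
end

section
/- For all real numbers a and b, sin²a + sin²(b − a) + sin²b ≤ 9/4; moreover equality is attained at a = 2π/3, b = −2π/3. -/
/-- For all real `a`, `b`, `sin²a + sin²(b − a) + sin²b ≤ 9/4`, with equality attained at
`a = 2π/3`, `b = −2π/3`. -/
theorem sin_sq_sum_le_and_eq :
    (∀ a b : ℝ, Real.sin a ^ 2 + Real.sin (b - a) ^ 2 + Real.sin b ^ 2 ≤ 9 / 4) ∧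
      Real.sin (2 * Real.pi / 3) ^ 2 +
        Real.sin (-(2 * Real.pi / 3) - 2 * Real.pi / 3) ^ 2 +
        Real.sin (-(2 * Real.pi / 3)) ^ 2 = 9 / 4 := by
  constructor
  · intro a b
    rw [Real.sin_sq_eq_half_sub a, Real.sin_sq_eq_half_sub b, Real.sin_sq_eq_half_sub (b - a),
      mul_sub, Real.cos_sub]
    nlinarith [sq_nonneg (1 + Real.cos (2 * a) + Real.cos (2 * b)),
      sq_nonneg (Real.sin (2 * a) + Real.sin (2 * b)),
      Real.sin_sq_add_cos_sq (2 * a), Real.sin_sq_add_cos_sq (2 * b)]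
  · have h1 : Real.sin (2 * Real.pi / 3) = Real.sqrt 3 / 2 := by
      rw [show 2 * Real.pi / 3 = Real.pi - Real.pi / 3 by ring, Real.sin_pi_sub,
        Real.sin_pi_div_three]
    have h2 : Real.sin (-(2 * Real.pi / 3) - 2 * Real.pi / 3) = Real.sqrt 3 / 2 := by
      rw [show -(2 * Real.pi / 3) - 2 * Real.pi / 3 = 2 * Real.pi / 3 - 2 * Real.pi by ring,
        Real.sin_sub_two_pi, h1]
    rw [h2, Real.sin_neg, h1]
    nlinarith [Real.sq_sqrt (show (0 : ℝ) ≤ 3 by norm_num)]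
end
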